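/- arXiv:1304.2385 — 3 statements merged into one kernel-verified Lean document; each statement's English description precedes it below -/
import Mathlib

section
/- Let A be an associative F-algebra with involution * and let e₁, e₂, e₃ ∈ A be pairwise orthogonal symmetric idempotents (eᵢ* = eᵢ, eᵢ² = eᵢ, and eᵢeⱼ = 0 for i ≠ j). Then for any distinct indices i, j, k ∈ {1,2,3} and any a, b ∈ A, one has the identity eᵢaeⱼbeₖ − (eᵢaeⱼbeₖ)* = [eᵢaeⱼ − eⱼa*eᵢ, eⱼbeₖ − eₖb*eⱼ]; in particular the element eᵢaeⱼbeₖ − (eᵢaeⱼbeₖ)* lies in the span of commutators of skew-symmetric elements [K(A,*), K(A,*)]. -/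
/-- Let `A` be an associative `F`-algebra (possibly non-unital) with involution `star`, and let
`e 0, e 1, e 2` be pairwise orthogonal symmetric idempotents.  Then for distinct indices
`i, j, k` and any `a b : A` we have the identity
`eᵢ a eⱼ b eₖ − (eᵢ a eⱼ b eₖ)* = [eᵢ a eⱼ − eⱼ a* eᵢ, eⱼ b eₖ − eₖ b* eⱼ]`,
and in particular `eᵢ a eⱼ b eₖ − (eᵢ a eⱼ b eₖ)*` lies in the `F`-span of commutators of
`star`-skew-symmetric elements. -/
theorem skew_sandwich_eq_commutator_and_mem_span
    {F A : Type*} [Field F] [NonUnitalRing A] [Module F A]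
    [SMulCommClass F A A] [IsScalarTower F A A] [StarRing A]
    (hstar_smul : ∀ (c : F) (x : A), star (c • x) = c • star x)
    (e : Fin 3 → A)
    (hsym : ∀ i, star (e i) = e i)
    (hidem : ∀ i, e i * e i = e i)
    (horth : ∀ i j, i ≠ j → e i * e j = 0)
    (i j k : Fin 3) (hij : i ≠ j) (hjk : j ≠ k) (hik : i ≠ k)
    (a b : A) :
    e i * a * e j * b * e k - star (e i * a * e j * b * e k) =
      (e i * a * e j - e j * star a * e i) * (e j * b * e k - e k * star b * e j)
        - (e j * b * e k - e k * star b * e j) * (e i * a * e j - e j * star a * e i)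
    ∧ e i * a * e j * b * e k - star (e i * a * e j * b * e k) ∈
        Submodule.span F
          {z : A | ∃ x y : A, star x = -x ∧ star y = -y ∧ z = x * y - y * x} := by
  have hself : ∀ x, e j * (e j * x) = e j * x := fun x => by rw [← mul_assoc, hidem]
  have hzero : ∀ p q, p ≠ q → ∀ x, e p * (e q * x) = 0 := fun p q h x => by
    rw [← mul_assoc, horth p q h, zero_mul]
  have hcomm : e i * a * e j * b * e k - star (e i * a * e j * b * e k) =
      (e i * a * e j - e j * star a * e i) * (e j * b * e k - e k * star b * e j)
        - (e j * b * e k - e k * star b * e j) * (e i * a * e j - e j * star a * e i) := by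
    simp only [star_mul, hsym, mul_sub, sub_mul, mul_assoc, hself, hzero i j hij,
      hzero j i hij.symm, hzero j k hjk, hzero k i hik.symm, hzero i k hik,
      mul_zero, sub_zero, zero_sub, sub_neg_eq_add, zero_add, hzero k j hjk.symm]
  refine ⟨hcomm, Submodule.subset_span ⟨_, _, ?_, ?_, hcomm⟩⟩ <;>
    simp [star_sub, star_mul, hsym, mul_assoc]
end

section
/- (Lemma 8) Let F be a field of characteristic not 2 and let d ≥ 1 be a positive integer. Equip R = F[t,t⁻¹] with the F-algebra involution determined by t* = t⁻¹, and equip M_d(R) with the involution (f_ij(t))* = (f_ji(t⁻¹)) (conjugate-transpose with respect to t ↦ t⁻¹). Then the Lie algebra [K(M_d(R),*), K(M_d(R),*)] is not a simple Lie algebra (i.e., it is either abelian or possesses a Lie ideal different from 0 and from the whole algebra). -/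
open LaurentPolynomial

namespace LaurentPolynomial

variable {F : Type*} [Field F]

/-- The symmetric element `2 - t - t⁻¹`, which vanishes at `t = 1`. -/
noncomputable def twoSubTSubTInv (F : Type*) [Field F] : F[T;T⁻¹] := 2 - T 1 - T (-1)

lemma invert_twoSubTSubTInv : invert (twoSubTSubTInv F) = twoSubTSubTInv F := by
  simp only [twoSubTSubTInv, map_sub, map_ofNat, invert_T, neg_neg]
  ring

lemma not_isUnit_twoSubTSubTInv : ¬ IsUnit (twoSubTSubTInv F) := by
  intro h
  have h' := h.map (eval₂ (RingHom.id F) (1 : Fˣ))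
  refine h'.ne_zero ?_
  simp only [twoSubTSubTInv, map_sub, map_ofNat, eval₂_T, one_zpow, Units.val_one]
  norm_num

lemma twoSubTSubTInv_ne_zero : twoSubTSubTInv F ≠ 0 := by
  intro h
  have h1 := congrArg (fun p : F[T;T⁻¹] => p.coeff 1) h
  rw [twoSubTSubTInv, ← map_ofNat C 2] at h1
  simp at h1

instance isNoetherianRing : IsNoetherianRing F[T;T⁻¹] :=
  IsLocalization.isNoetherianRing (Submonoid.powers (Polynomial.X : Polynomial F)) _ inferInstance

lemma exists_not_pow_dvd {p q : F[T;T⁻¹]} (hp : ¬ IsUnit p) (hq : q ≠ 0) :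
    ∃ n : ℕ, ¬ p ^ n ∣ q := by
  obtain ⟨n, hn⟩ := FiniteMultiplicity.of_not_isUnit hp hq
  exact ⟨n + 1, hn⟩

/-- A space of matrices contained in its multiple by a nonunit of `F[T;T⁻¹]` is zero. -/
lemma matrix_submodule_eq_bot_of_le_smul {ι : Type*} {c : F[T;T⁻¹]} (hc : ¬ IsUnit c)
    {L : Submodule F (Matrix ι ι F[T;T⁻¹])} (h : ∀ x ∈ L, ∃ y ∈ L, c • y = x) : L = ⊥ := by
  have key : ∀ n : ℕ, ∀ x ∈ L, ∃ y ∈ L, c ^ n • y = x := by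
    intro n
    induction n with
    | zero => exact fun x hx => ⟨x, hx, by simp⟩
    | succ n ih =>
      intro x hx
      obtain ⟨y, hy, rfl⟩ := ih x hx
      obtain ⟨z, hz, rfl⟩ := h y hy
      exact ⟨z, hz, by rw [smul_smul, pow_succ]⟩
  rw [Submodule.eq_bot_iff]
  intro x hx
  ext1 i j
  by_contra hij
  obtain ⟨n, hn⟩ := exists_not_pow_dvd hc hij
  obtain ⟨y, -, rfl⟩ := key n x hx
  exact hn ⟨y i j, by simp⟩

end LaurentPolynomial

/-- **Lemma 8.**
Let `F` be a field of characteristic not 2 and `d ≥ 1`.  Equip `R = F[T;T⁻¹]` with the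
involution `t ↦ t⁻¹` (i.e. `LaurentPolynomial.invert`) and `M_d(R)` with the
conjugate-transpose involution `(f_ij(t))* = (f_ji(t⁻¹))`.  Then the Lie algebra
`[K(M_d(R),*), K(M_d(R),*)]` (the `F`-span `L` of commutators of skew-symmetric matrices)
is not simple: either it is abelian, or it possesses a Lie ideal different from `0` and
from `L` itself. -/
theorem commutator_skew_matrix_laurent_not_simple
    {F : Type*} [Field F] (hF : (2 : F) ≠ 0) (d : ℕ) (hd : 1 ≤ d) :
    ∀ mstar : Matrix (Fin d) (Fin d) F[T;T⁻¹] → Matrix (Fin d) (Fin d) F[T;T⁻¹],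
      (mstar = fun M => M.transpose.map (fun p => invert p)) →
      ∀ L : Submodule F (Matrix (Fin d) (Fin d) F[T;T⁻¹]),
        L = Submodule.span F
              {z | ∃ x y, mstar x = -x ∧ mstar y = -y ∧ z = x * y - y * x} →
        (∀ x ∈ L, ∀ y ∈ L, x * y - y * x = 0) ∨
        (∃ I : Submodule F (Matrix (Fin d) (Fin d) F[T;T⁻¹]),
          I ≤ L ∧ (∀ x ∈ L, ∀ y ∈ I, x * y - y * x ∈ I) ∧ I ≠ ⊥ ∧ I ≠ L) := by
  intro mstar hstar L hL
  set c := twoSubTSubTInv F with hc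
  have star_mul : ∀ x y, mstar (x * y) = mstar y * mstar x := by
    intro x y
    subst hstar; ext1 i j
    simp [Matrix.mul_apply, map_sum, mul_comm]
  have star_sub : ∀ x y, mstar (x - y) = mstar x - mstar y := by
    intro x y
    subst hstar; ext1 i j; simp
  have star_add : ∀ x y, mstar (x + y) = mstar x + mstar y := by
    intro x y
    subst hstar; ext1 i j; simp
  have star_smul : ∀ (a : F) x, mstar (a • x) = a • mstar x := by
    intro a x
    subst hstar; ext1 i j; simp
  have star_csmul : ∀ x, mstar (c • x) = c • mstar x := by
    intro x
    subst hstar; ext1 i j; simp [hc, invert_twoSubTSubTInv]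
  have skew_of_mem : ∀ x ∈ L, mstar x = -x := by
    intro x hx
    rw [hL] at hx
    induction hx using Submodule.span_induction with
    | mem z hz =>
      obtain ⟨x, y, hx, hy, rfl⟩ := hz
      rw [star_sub, star_mul, star_mul, hx, hy]
      noncomm_ring
    | zero => subst hstar; ext1 i j; simp
    | add x y _ _ hx hy => rw [star_add, hx, hy]; abel
    | smul a x _ hx => rw [star_smul, hx, smul_neg]
  have bracket_mem : ∀ x ∈ L, ∀ y ∈ L, x * y - y * x ∈ L := by
    intro x hx y hy
    have hx' := skew_of_mem x hx
    have hy' := skew_of_mem y hy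
    rw [hL]
    exact Submodule.subset_span ⟨x, y, hx', hy', rfl⟩
  have smul_mem : ∀ x ∈ L, c • x ∈ L := by
    intro x hx
    rw [hL] at hx ⊢
    induction hx using Submodule.span_induction with
    | mem z hz =>
      obtain ⟨x, y, hx, hy, rfl⟩ := hz
      refine Submodule.subset_span ⟨c • x, y, ?_, hy, ?_⟩
      · rw [star_csmul, hx, smul_neg]
      · rw [smul_sub, Matrix.smul_mul, Matrix.mul_smul]
    | zero => rw [smul_zero]; exact Submodule.zero_mem _
    | add x y _ _ hx hy => rw [smul_add]; exact Submodule.add_mem _ hx hy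
    | smul a x _ hx => rw [smul_comm]; exact Submodule.smul_mem _ a hx
  by_cases hbot : L = ⊥
  · left
    intro x hx y _
    rw [hbot, Submodule.mem_bot] at hx
    simp [hx]
  right
  refine ⟨L.map (LinearMap.lsmul F[T;T⁻¹] (Matrix (Fin d) (Fin d) F[T;T⁻¹]) c |>.restrictScalars F),
    ?_, ?_, ?_, ?_⟩
  · rintro _ ⟨x, hx, rfl⟩
    exact smul_mem x hx
  · rintro x hx _ ⟨y, hy, rfl⟩
    exact ⟨x * y - y * x, bracket_mem x hx y hy, by simp [smul_sub]⟩
  · intro h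
    apply hbot
    rw [Submodule.eq_bot_iff] at h ⊢
    intro x hx
    have hcx : c • x = 0 := h _ ⟨x, hx, rfl⟩
    ext1 i j
    have := congrFun (congrFun hcx i) j
    simpa [hc, twoSubTSubTInv_ne_zero] using this
  · intro h
    refine hbot (matrix_submodule_eq_bot_of_le_smul not_isUnit_twoSubTSubTInv fun x hx => ?_)
    rw [← h] at hx
    exact hx
end

section
/- Let F be a field of characteristic not 2, let d ≥ 2 and n ≥ 1 be integers, and let J_n be the ideal of R = F[t,t⁻¹] generated by (1−t)ⁿ. Then [K(M_d(J_n),*), K(M_d(J_n),*)] ≠ 0; explicitly, there exist matrices x, y ∈ M_d(R) with all entries in J_n satisfying x* = −x and y* = −y and [x,y] = xy − yx ≠ 0. (For instance, with d = 2, x and y having (1,2)-entries f(t) = (1−t)ⁿ and g(t) = (1−t)ᵐ for n < m, (2,1)-entries −f(t⁻¹) and −g(t⁻¹), and zeros elsewhere, satisfy [x,y] = diag(g(t)f(t⁻¹) − f(t)g(t⁻¹), f(t)g(t⁻¹) − f(t⁻¹)g(t)) ≠ 0.) -/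
open LaurentPolynomial

/-- The matrix with entry `p` at `(i, j)`, entry `-p(t⁻¹)` at `(j, i)` and zeros elsewhere. -/
noncomputable def skewSingle {ι R : Type*} [DecidableEq ι] [CommRing R] (i j : ι) (p : R[T;T⁻¹]) :
    Matrix ι ι R[T;T⁻¹] :=
  Matrix.single i j p - Matrix.single j i (invert p)

theorem skewSingle_transpose_map_invert {ι R : Type*} [DecidableEq ι] [CommRing R] (i j : ι)
    (p : R[T;T⁻¹]) :
    (skewSingle i j p).transpose.map (fun q => invert q) = -skewSingle i j p := by
  ext1 a b
  simp only [skewSingle, Matrix.map_apply, Matrix.transpose_apply, Matrix.sub_apply,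
    Matrix.neg_apply, Matrix.single_apply, map_sub, apply_ite (invert (R := R)), map_zero,
    involutive_invert p, and_comm, neg_sub]

theorem skewSingle_apply_mem {ι R : Type*} [DecidableEq ι] [CommRing R] (i j : ι)
    {p : R[T;T⁻¹]} {J : Ideal R[T;T⁻¹]} (hp : p ∈ J) (hp' : invert p ∈ J) (a b : ι) :
    skewSingle i j p a b ∈ J := by
  simp only [skewSingle, Matrix.sub_apply, Matrix.single_apply]
  refine J.sub_mem ?_ ?_ <;> split_ifs <;> simp [*]

theorem skewSingle_commutator_apply {ι R : Type*} [DecidableEq ι] [Fintype ι] [CommRing R]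
    {i j : ι} (hij : i ≠ j) (p q : R[T;T⁻¹]) :
    (skewSingle i j p * skewSingle i j q - skewSingle i j q * skewSingle i j p) i i =
      q * invert p - p * invert q := by
  simp [skewSingle, sub_mul, mul_sub, hij, hij.symm]
  ring

theorem invert_one_sub_T_pow {R : Type*} [CommRing R] (n : ℕ) :
    invert ((1 - T 1 : R[T;T⁻¹]) ^ n) = (-T (-1)) ^ n * (1 - T 1) ^ n := by
  rw [← mul_pow, map_pow]
  congr 1
  have h : (T (-1) * T 1 : R[T;T⁻¹]) = 1 := by rw [← T_add]; exact T_zero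
  rw [map_sub, map_one, invert_T]
  linear_combination -h

theorem T_ne_T {R : Type*} [Semiring R] [Nontrivial R] {m n : ℤ} (h : m ≠ n) :
    (T m : R[T;T⁻¹]) ≠ T n := fun e => by
  have := congrArg (fun p => p.coeff m) e
  simp [h.symm] at this

/-- Let `F` be a field of characteristic not 2, `d ≥ 2`, `n ≥ 1`, and let `J_n` be the ideal of
`R = F[T;T⁻¹]` generated by `(1 − t)ⁿ`.  Then `[K(M_d(J_n),*), K(M_d(J_n),*)] ≠ 0`:
there exist `d × d` matrices `x, y` with all entries in `J_n` which are skew-symmetric for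
the involution `(f_ij(t))* = (f_ji(t⁻¹))` and satisfy `x*y − y*x ≠ 0`. -/
theorem exists_skew_matrices_entries_in_ideal_commutator_ne_zero
    {F : Type*} [Field F] (hF : (2 : F) ≠ 0) (d n : ℕ) (hd : 2 ≤ d) (hn : 1 ≤ n) :
    ∃ x y : Matrix (Fin d) (Fin d) F[T;T⁻¹],
      (∀ i j, x i j ∈ Ideal.span {((1 : F[T;T⁻¹]) - T 1) ^ n}) ∧
      (∀ i j, y i j ∈ Ideal.span {((1 : F[T;T⁻¹]) - T 1) ^ n}) ∧
      x.transpose.map (fun p => invert p) = -x ∧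
      y.transpose.map (fun p => invert p) = -y ∧
      x * y - y * x ≠ 0 := by
  let i : Fin d := ⟨0, by omega⟩
  let j : Fin d := ⟨1, by omega⟩
  have hij : i ≠ j := by simp [i, j]
  set f : F[T;T⁻¹] := (1 - T 1) ^ n with hf
  have hfi : invert f = (-T (-1)) ^ n * f := invert_one_sub_T_pow n
  have hmem : f ∈ Ideal.span {f} := Ideal.mem_span_singleton_self f
  have hmem' : invert f ∈ Ideal.span {f} := hfi ▸ Ideal.mul_mem_left _ _ hmem
  refine ⟨skewSingle i j f, skewSingle i j (T 1 * f), skewSingle_apply_mem i j hmem hmem',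
    skewSingle_apply_mem i j (Ideal.mul_mem_left _ _ hmem) ?_,
    skewSingle_transpose_map_invert i j f, skewSingle_transpose_map_invert i j _, fun h => ?_⟩
  · rw [map_mul]
    exact Ideal.mul_mem_left _ _ hmem'
  · have hf0 : f ≠ 0 :=
      pow_ne_zero n (sub_ne_zero.2 (T_zero (R := F) ▸ T_ne_T zero_ne_one))
    have hfi0 : invert f ≠ 0 := by simpa using hf0
    have hT : (T 1 - T (-1) : F[T;T⁻¹]) ≠ 0 := sub_ne_zero.2 (T_ne_T (by decide))
    have h0 := congrFun (congrFun h i) i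
    rw [skewSingle_commutator_apply hij, map_mul, invert_T, Matrix.zero_apply] at h0
    refine mul_ne_zero (mul_ne_zero hf0 hfi0) hT ?_
    rw [← h0]
    ring
end
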